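/- Let $t_0, t_1, t_2$ be pairwise distinct elements of a field, and let integers $g, k_1, k_2$ be given with $k_1, k_2 < -1$ and $g \geq 2$. Then $(g-1)\operatorname{tr}(A^{g-2}M_1^{-k_1}M_2^{-k_2}B) - k_1 \operatorname{tr}(A^{g-1}M_1^{-k_1-1}M_2^{-k_2}N) - k_2\operatorname{tr}(A^{g-1}M_1^{-k_1}M_2^{-k_2-1}N) = (t_0-t_1)^{g-k_1-3}(t_0-t_2)^{g-k_2-3}\big((4g-4-k_1-k_2)t_0 - (2g-2-k_2)t_1 - (2g-2-k_1)t_2\big)$, where $A, M_1, M_2, N, B$ are the explicit $3\times 3$ matrices: $A=\operatorname{diag}((t_0-t_1)(t_0-t_2),(t_1-t_0)(t_1-t_2),(t_2-t_0)(t_2-t_1))$; $M_1=\operatorname{diag}(t_0-t_1,0,t_2-t_1)$; $M_2=\operatorname{diag}(t_0-t_2,t_1-t_2,0)$; $N$ has all columns equal to $\big(\frac{1}{(t_0-t_1)(t_0-t_2)},\frac{1}{(t_1-t_0)(t_1-t_2)},\frac{1}{(t_2-t_0)(t_2-t_1)}\big)^T$; and $B$ has $(i,j)$ entry $\frac{t_i+t_j-2t_l}{(t_i-t_{i'})(t_i-t_{i''})}$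 for $i\neq j$ with $l$ the remaining index, and diagonal entries $\frac{2(2t_i-t_{i'}-t_{i''})}{(t_i-t_{i'})(t_i-t_{i''})}$. -/

import Mathlib

theorem GW_partition_function_trace {F : Type*} [Field F] (t0 t1 t2 : F)
    (h01 : t0 ≠ t1) (h02 : t0 ≠ t2) (h12 : t1 ≠ t2)
    (g : ℕ) (hg : 2 ≤ g) (k1 k2 : ℤ) (hk1 : k1 < -1) (hk2 : k2 < -1)
    (A M1 M2 N B : Matrix (Fin 3) (Fin 3) F)
    (hA : A = Matrix.diagonal ![(t0 - t1) * (t0 - t2), (t1 - t0) * (t1 - t2), (t2 - t0) * (t2 - t1)])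
    (hM1 : M1 = Matrix.diagonal ![t0 - t1, 0, t2 - t1])
    (hM2 : M2 = Matrix.diagonal ![t0 - t2, t1 - t2, 0])
    (hN : N = !![1 / ((t0 - t1) * (t0 - t2)), 1 / ((t0 - t1) * (t0 - t2)), 1 / ((t0 - t1) * (t0 - t2));
                 1 / ((t1 - t0) * (t1 - t2)), 1 / ((t1 - t0) * (t1 - t2)), 1 / ((t1 - t0) * (t1 - t2));
                 1 / ((t2 - t0) * (t2 - t1)), 1 / ((t2 - t0) * (t2 - t1)), 1 / ((t2 - t0) * (t2 - t1))])
    (hB : B = !![2 * (2 * t0 - t1 - t2) / ((t0 - t1) * (t0 - t2)),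
                 (t0 + t1 - 2 * t2) / ((t0 - t1) * (t0 - t2)),
                 (t0 + t2 - 2 * t1) / ((t0 - t1) * (t0 - t2));
                 (t0 + t1 - 2 * t2) / ((t1 - t0) * (t1 - t2)),
                 2 * (2 * t1 - t0 - t2) / ((t1 - t0) * (t1 - t2)),
                 (t1 + t2 - 2 * t0) / ((t1 - t0) * (t1 - t2));
                 (t0 + t2 - 2 * t1) / ((t2 - t0) * (t2 - t1)),
                 (t1 + t2 - 2 * t0) / ((t2 - t0) * (t2 - t1)),
                 2 * (2 * t2 - t0 - t1) / ((t2 - t0) * (t2 - t1))]) :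
    ((g : F) - 1) * Matrix.trace (A ^ (g - 2) * M1 ^ (-k1).toNat * M2 ^ (-k2).toNat * B)
      - (k1 : F) * Matrix.trace (A ^ (g - 1) * M1 ^ (-k1 - 1).toNat * M2 ^ (-k2).toNat * N)
      - (k2 : F) * Matrix.trace (A ^ (g - 1) * M1 ^ (-k1).toNat * M2 ^ (-k2 - 1).toNat * N)
    = (t0 - t1) ^ ((g : ℤ) - k1 - 3).toNat * (t0 - t2) ^ ((g : ℤ) - k2 - 3).toNat
        * (((4 * (g : ℤ) - 4 - k1 - k2 : ℤ) : F) * t0 - ((2 * (g : ℤ) - 2 - k2 : ℤ) : F) * t1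
            - ((2 * (g : ℤ) - 2 - k1 : ℤ) : F) * t2) := by
  obtain ⟨n, rfl⟩ : ∃ n : ℕ, g = n + 2 := ⟨g - 2, by omega⟩
  obtain ⟨a, rfl⟩ : ∃ a : ℕ, k1 = -((a : ℤ) + 2) := ⟨(-k1 - 2).toNat, by omega⟩
  obtain ⟨b, rfl⟩ : ∃ b : ℕ, k2 = -((b : ℤ) + 2) := ⟨(-k2 - 2).toNat, by omega⟩
  have e1 : (-(-((a : ℤ) + 2))).toNat = a + 2 := by omega
  have e2 : (-(-((b : ℤ) + 2))).toNat = b + 2 := by omega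
  have e3 : (-(-((a : ℤ) + 2)) - 1).toNat = a + 1 := by omega
  have e4 : (-(-((b : ℤ) + 2)) - 1).toNat = b + 1 := by omega
  have e5 : (((n + 2 : ℕ) : ℤ) - (-((a : ℤ) + 2)) - 3).toNat = n + a + 1 := by omega
  have e6 : (((n + 2 : ℕ) : ℤ) - (-((b : ℤ) + 2)) - 3).toNat = n + b + 1 := by omega
  have e7 : n + 2 - 2 = n := by omega
  have e8 : n + 2 - 1 = n + 1 := by omega
  rw [e1, e2, e3, e4, e5, e6, e7, e8]
  have hx : t0 - t1 ≠ 0 := sub_ne_zero.mpr h01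
  have hy : t0 - t2 ≠ 0 := sub_ne_zero.mpr h02
  subst hA hM1 hM2 hN hB
  simp only [Matrix.diagonal_pow, Matrix.diagonal_mul_diagonal, Matrix.trace, Matrix.diag,
    Matrix.diagonal_mul, Fin.sum_univ_three]
  simp
  obtain ⟨x, rfl⟩ : ∃ x, t1 = t0 - x := ⟨t0 - t1, by ring⟩
  obtain ⟨y, rfl⟩ : ∃ y, t2 = t0 - y := ⟨t0 - t2, by ring⟩
  simp only [sub_sub_cancel] at hx hy ⊢
  field_simp
  ring
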